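/- Let G be a graph on {0,...,2k+1} with k ≥ 2 such that G - 0 is the complement of C_{2k+1} and α(G) = 2. Then G is LS_+-perfect if and only if deg_G(0) = 2k+1 (i.e., G is the complete join of node 0 with the complement of C_{2k+1}). -/

import Mathlib

def IsStable {V : Type*} (G : SimpleGraph V) (S : Set V) : Prop :=
  ∀ u ∈ S, ∀ v ∈ S, ¬ G.Adj u v

noncomputable def STAB {V : Type*} (G : SimpleGraph V) : Set (V → ℝ) :=
  convexHull ℝ {x | ∃ S : Set V, IsStable G S ∧ x = S.indicator 1}

noncomputable def stabNum {V : Type*} (G : SimpleGraph V) : ℕ :=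
  sSup {n | ∃ S : Set V, IsStable G S ∧ S.ncard = n}

def FRAC {V : Type*} (G : SimpleGraph V) : Set (V → ℝ) :=
  {x | (∀ v, 0 ≤ x v ∧ x v ≤ 1) ∧ ∀ u v, G.Adj u v → x u + x v ≤ 1}

def coneK {ι : Type*} (K : Set (ι → ℝ)) : Set (Option ι → ℝ) :=
  {z | ∃ c : ℝ, 0 ≤ c ∧ ∃ y ∈ K, z none = c ∧ ∀ i, z (some i) = c * y i}

def LSplus {ι : Type} [Fintype ι] [DecidableEq ι] (K : Set (ι → ℝ)) : Set (ι → ℝ) :=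
  {x | (∀ i, 0 ≤ x i ∧ x i ≤ 1) ∧
    ∃ Y : Matrix (Option ι) (Option ι) ℝ, Y.PosSemidef ∧
      Y none none = 1 ∧
      (∀ j, Y j none = Y j j) ∧
      (∀ i, Y (some i) none = x i) ∧
      (∀ i, (fun j => Y j (some i)) ∈ coneK K) ∧
      (∀ i, (fun j => Y j none - Y j (some i)) ∈ coneK K)}

/-- Nodes `i,j ∈ {1,…,2k+1}` are consecutive on the cycle `C_{2k+1}`. -/
def consec (k : ℕ) (i j : Fin (2*k+2)) : Prop :=
  (j : ℕ) = (i : ℕ) + 1 ∨ (i : ℕ) = (j : ℕ) + 1 ∨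
    ((i : ℕ) = 1 ∧ (j : ℕ) = 2*k+1) ∨ ((i : ℕ) = 2*k+1 ∧ (j : ℕ) = 1)


lemma mem_coneK_FRAC {V : Type*} (G : SimpleGraph V) (z : Option V → ℝ) :
    z ∈ coneK (FRAC G) ↔ 0 ≤ z none ∧ (∀ i, 0 ≤ z (some i) ∧ z (some i) ≤ z none) ∧
      ∀ u v, G.Adj u v → z (some u) + z (some v) ≤ z none := by
  constructor
  · rintro ⟨c, hc, y, ⟨hy1, hy2⟩, h0, h⟩
    rw [h0]
    refine ⟨hc, fun i => ?_, fun u v huv => ?_⟩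
    · rw [h i]
      exact ⟨mul_nonneg hc (hy1 i).1, mul_le_of_le_one_right hc (hy1 i).2⟩
    · rw [h u, h v, ← mul_add]
      exact mul_le_of_le_one_right hc (hy2 u v huv)
  · rintro ⟨h0, h1, h2⟩
    rcases h0.eq_or_lt with h0' | h0'
    · refine ⟨0, le_rfl, 0, ⟨by simp, by simp⟩, h0'.symm, fun i => ?_⟩
      have := h1 i
      simp only [zero_mul]
      linarith [this.1, this.2]
    · refine ⟨z none, h0, fun i => z (some i) / z none, ⟨fun i => ⟨?_, ?_⟩, fun u v huv => ?_⟩,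
        rfl, fun i => ?_⟩
      · exact div_nonneg (h1 i).1 h0
      · exact (div_le_one h0').2 (h1 i).2
      · rw [← add_div]
        exact (div_le_one h0').2 (h2 u v huv)
      · field_simp

lemma convex_LSplus {V : Type} [Fintype V] [DecidableEq V] (G : SimpleGraph V) :
    Convex ℝ (LSplus (FRAC G)) := by
  rintro x ⟨hx, Y, hY, hY0, hY1, hY2, hY3, hY4⟩ y ⟨hy, Z, hZ, hZ0, hZ1, hZ2, hZ3, hZ4⟩ a b ha hb hab
  simp only [mem_coneK_FRAC] at hY3 hY4 hZ3 hZ4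
  refine ⟨fun i => ⟨?_, ?_⟩, a • Y + b • Z, (hY.smul ha).add (hZ.smul hb), ?_, ?_, ?_, ?_, ?_⟩
  · have h1 := mul_nonneg ha (hx i).1
    have h2 := mul_nonneg hb (hy i).1
    simp only [Pi.add_apply, Pi.smul_apply, smul_eq_mul]
    linarith
  · have h1 := mul_le_mul_of_nonneg_left (hx i).2 ha
    have h2 := mul_le_mul_of_nonneg_left (hy i).2 hb
    simp only [Pi.add_apply, Pi.smul_apply, smul_eq_mul]
    linarith
  · simp [hY0, hZ0, hab]
  · intro j
    simp [hY1 j, hZ1 j]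
  · intro j
    simp [hY2 j, hZ2 j]
  · intro i
    obtain ⟨p1, p2, p3⟩ := hY3 i
    obtain ⟨q1, q2, q3⟩ := hZ3 i
    rw [mem_coneK_FRAC]
    simp only [Matrix.add_apply, Matrix.smul_apply, smul_eq_mul]
    refine ⟨by positivity, fun j => ⟨?_, ?_⟩, fun u v huv => ?_⟩
    · have h1 := mul_nonneg ha (p2 j).1
      have h2 := mul_nonneg hb (q2 j).1
      linarith
    · have h1 := mul_le_mul_of_nonneg_left (p2 j).2 ha
      have h2 := mul_le_mul_of_nonneg_left (q2 j).2 hb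
      linarith
    · have h1 := mul_le_mul_of_nonneg_left (p3 u v huv) ha
      have h2 := mul_le_mul_of_nonneg_left (q3 u v huv) hb
      linarith
  · intro i
    obtain ⟨p1, p2, p3⟩ := hY4 i
    obtain ⟨q1, q2, q3⟩ := hZ4 i
    rw [mem_coneK_FRAC]
    simp only [Matrix.add_apply, Matrix.smul_apply, smul_eq_mul]
    refine ⟨?_, fun j => ⟨?_, ?_⟩, fun u v huv => ?_⟩
    · have h1 := mul_nonneg ha p1
      have h2 := mul_nonneg hb q1
      linarith
    · have h1 := mul_nonneg ha (p2 j).1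
      have h2 := mul_nonneg hb (q2 j).1
      linarith
    · have h1 := mul_le_mul_of_nonneg_left (p2 j).2 ha
      have h2 := mul_le_mul_of_nonneg_left (q2 j).2 hb
      linarith
    · have h1 := mul_le_mul_of_nonneg_left (p3 u v huv) ha
      have h2 := mul_le_mul_of_nonneg_left (q3 u v huv) hb
      linarith

lemma STAB_subset_LSplus {V : Type} [Fintype V] [DecidableEq V] (G : SimpleGraph V) :
    STAB G ⊆ LSplus (FRAC G) := by
  classical
  refine convexHull_min ?_ (convex_LSplus G)
  rintro x ⟨S, hS, rfl⟩
  have h01 : ∀ i, (S.indicator (1 : V → ℝ)) i = 0 ∨ (S.indicator (1 : V → ℝ)) i = 1 := by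
    intro i
    by_cases hi : i ∈ S <;> simp [hi]
  have hadj : ∀ u v, G.Adj u v →
      (S.indicator (1 : V → ℝ)) u = 0 ∨ (S.indicator (1 : V → ℝ)) v = 0 := by
    intro u v huv
    by_cases hu : u ∈ S
    · by_cases hv : v ∈ S
      · exact absurd huv (hS u hu v hv)
      · right; simp [hv]
    · left; simp [hu]
  generalize (S.indicator (1 : V → ℝ)) = χ at h01 hadj
  let w : Option V → ℝ := fun o => o.elim 1 χ
  refine ⟨fun i => by rcases h01 i with h | h <;> simp [h], Matrix.vecMulVec w w, ?_, ?_, ?_, ?_, ?_, ?_⟩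
  · simpa using Matrix.posSemidef_vecMulVec_self_star w
  · simp [Matrix.vecMulVec_apply, w]
  · rintro (_ | j)
    · simp
    · rcases h01 j with h | h <;> simp [Matrix.vecMulVec_apply, w, h]
  · intro i; simp [Matrix.vecMulVec_apply, w]
  · intro i
    rw [mem_coneK_FRAC]
    simp only [Matrix.vecMulVec_apply, w, Option.elim]
    refine ⟨by rcases h01 i with h | h <;> simp [h], fun j => ?_, fun u v huv => ?_⟩
    · rcases h01 i with h | h <;> rcases h01 j with h' | h' <;> simp [h, h']
    · rcases hadj u v huv with h' | h'
      · rcases h01 i with h | h <;> rcases h01 v with h'' | h'' <;> simp [h, h', h'']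
      · rcases h01 i with h | h <;> rcases h01 u with h'' | h'' <;> simp [h, h', h'']
  · intro i
    rw [mem_coneK_FRAC]
    simp only [Matrix.vecMulVec_apply, w, Option.elim]
    refine ⟨by rcases h01 i with h | h <;> simp [h], fun j => ?_, fun u v huv => ?_⟩
    · rcases h01 i with h | h <;> rcases h01 j with h' | h' <;> simp [h, h']
    · rcases hadj u v huv with h' | h'
      · rcases h01 i with h | h <;> rcases h01 v with h'' | h'' <;> simp [h, h', h'']
      · rcases h01 i with h | h <;> rcases h01 u with h'' | h'' <;> simp [h, h', h'']

lemma psd_valid {V : Type} [Fintype V] (Y : Matrix (Option V) (Option V) ℝ)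
    (hY : Y.PosSemidef) (h0 : Y none none = 1) (x a : V → ℝ) (b : ℝ) (hb : 0 < b)
    (ha : ∀ i, 0 ≤ a i) (hx : ∀ i, Y (some i) none = x i)
    (h : ∀ i, 0 < a i → ∑ j, a j * Y (some j) (some i) ≤ b * x i) :
    ∑ i, a i * x i ≤ b := by
  have hsym : ∀ i, Y none (some i) = x i := by
    intro i
    rw [← hx i]
    have := hY.isHermitian.apply (some i) none
    simpa using this
  let z : Option V → ℝ := fun o => o.elim b (fun i => - a i)
  have hq := hY.dotProduct_mulVec_nonneg z
  have e : star z ⬝ᵥ Y.mulVec z = b * b - 2 * b * (∑ i, a i * x i)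
      + ∑ i, a i * ∑ j, a j * Y (some j) (some i) := by
    simp only [dotProduct, Matrix.mulVec, Fintype.sum_option, z, Option.elim, star_trivial, h0, hx, hsym,
      Pi.star_apply]
    have hs : ∀ i j, Y (some i) (some j) = Y (some j) (some i) := by
      intro i j
      have := hY.isHermitian.apply (some j) (some i)
      simpa using this
    simp only [mul_add, Finset.sum_add_distrib, Finset.mul_sum]
    have e1 : ∑ i, b * (x i * -a i) = - (b * ∑ i, a i * x i) := by
      rw [Finset.mul_sum, ← Finset.sum_neg_distrib]
      exact Finset.sum_congr rfl fun i _ => by ring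
    have e2 : ∑ i, -a i * (x i * b) = - (b * ∑ i, a i * x i) := by
      rw [Finset.mul_sum, ← Finset.sum_neg_distrib]
      exact Finset.sum_congr rfl fun i _ => by ring
    have e3 : ∑ i, ∑ j, -a i * (Y (some i) (some j) * -a j)
        = ∑ i, ∑ j, a i * (a j * Y (some j) (some i)) := by
      refine Finset.sum_congr rfl fun i _ => Finset.sum_congr rfl fun j _ => ?_
      rw [hs i j]; ring
    have e4 : ∑ i, 2 * b * (a i * x i) = 2 * (b * ∑ i, a i * x i) := by
      rw [Finset.mul_sum, Finset.mul_sum]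
      exact Finset.sum_congr rfl fun i _ => by ring
    rw [e1, e2, e3, e4]; ring
  have hle : ∑ i, a i * ∑ j, a j * Y (some j) (some i) ≤ ∑ i, a i * (b * x i) := by
    refine Finset.sum_le_sum fun i _ => ?_
    rcases (ha i).eq_or_lt with h' | h'
    · simp [← h']
    · exact mul_le_mul_of_nonneg_left (h i h') (ha i)
  have e5 : ∑ i, a i * (b * x i) = b * ∑ i, a i * x i := by
    rw [Finset.mul_sum]
    exact Finset.sum_congr rfl fun i _ => by ring
  rw [e] at hq
  have : 0 ≤ b * (b - ∑ i, a i * x i) := by nlinarith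
  have := nonneg_of_mul_nonneg_right this hb
  linarith

lemma integral_step (B c : ℝ) (hc : 0 ≤ c) (hB : c ≤ B) :
    ∫ t in (0 : ℝ)..B, (if t < c then (1 : ℝ) else 0) = c := by
  have hanti : Antitone (fun t : ℝ => if t < c then (1 : ℝ) else 0) := by
    intro s t hst
    dsimp only
    split_ifs <;> first | linarith | norm_num
  rw [← intervalIntegral.integral_add_adjacent_intervals (b := c)
    hanti.intervalIntegrable hanti.intervalIntegrable]
  have h1 : ∫ t in (0 : ℝ)..c, (if t < c then (1 : ℝ) else 0) = ∫ t in (0 : ℝ)..c, (1 : ℝ) := by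
    apply intervalIntegral.integral_congr_ae
    have : ∀ᵐ t ∂(MeasureTheory.volume : MeasureTheory.Measure ℝ), t ≠ c := by
      simp [MeasureTheory.ae_iff]
    filter_upwards [this] with t ht hmem
    rw [Set.uIoc_of_le hc] at hmem
    rw [if_pos (lt_of_le_of_ne hmem.2 ht)]
  have h2 : ∫ t in c..B, (if t < c then (1 : ℝ) else 0) = ∫ t in c..B, (0 : ℝ) := by
    apply intervalIntegral.integral_congr
    intro t ht
    rw [Set.uIcc_of_le hB] at ht
    dsimp only
    rw [if_neg (not_lt.2 ht.1)]
  rw [h1, h2]; simp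

lemma path_bound (k : ℕ) (c x : Fin (2*k+2) → ℝ) (B M : ℝ) (p : Fin (2*k+2))
    (hB : 0 ≤ B)
    (hc0 : ∀ i, i ≠ 0 → 0 ≤ c i) (hcB : ∀ i, i ≠ 0 → c i ≤ B)
    (hcc : ∀ i j, i ≠ 0 → j ≠ 0 → consec k i j → c i + c j ≤ B)
    (hp0 : p ≠ 0) (hp : c p = 0)
    (hM : ∀ S : Finset (Fin (2*k+2)), 0 ∉ S → (∀ i ∈ S, ∀ j ∈ S, ¬ consec k i j) →
      ∑ i ∈ S, x i ≤ M) :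
    ∑ i ∈ Finset.univ.erase 0, c i * x i ≤ B * M := by
  classical
  let col : Fin (2*k+2) → Prop := fun i => if i < p then (i : ℕ) % 2 = 0 else (i : ℕ) % 2 = 1
  let φ : Fin (2*k+2) → ℝ → ℝ := fun i t =>
    if col i then (if t < c i then 1 else 0) else (if B - t < c i then 1 else 0)
  have hint : ∀ i, IntervalIntegrable (φ i) MeasureTheory.volume 0 B := by
    intro i
    by_cases hcol : col i
    · have : Antitone (φ i) := by
        intro s t hst
        simp only [φ, hcol, if_true]
        split_ifs <;> first | linarith | norm_num
      exact this.intervalIntegrable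
    · have : Monotone (φ i) := by
        intro s t hst
        simp only [φ, hcol, if_false]
        split_ifs <;> first | linarith | norm_num
      exact this.intervalIntegrable
  have hval : ∀ i, i ≠ 0 → ∫ t in (0 : ℝ)..B, φ i t = c i := by
    intro i hi
    by_cases hcol : col i
    · simp only [φ, hcol, if_true]
      exact integral_step B (c i) (hc0 i hi) (hcB i hi)
    · simp only [φ, hcol, if_false]
      have := intervalIntegral.integral_comp_sub_left (a := 0) (b := B)
        (fun t : ℝ => if t < c i then (1 : ℝ) else 0) B
      rw [this]
      simpa using integral_step B (c i) (hc0 i hi) (hcB i hi)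
  have hpt : ∀ t ∈ Set.Icc (0 : ℝ) B, ∑ i ∈ (Finset.univ.erase 0).erase p, φ i t * x i ≤ M := by
    intro t ht
    have h1 : ∑ i ∈ (Finset.univ.erase 0).erase p, φ i t * x i
        = ∑ i ∈ ((Finset.univ.erase 0).erase p).filter
            (fun i => if col i then t < c i else B - t < c i), x i := by
      rw [Finset.sum_filter]
      refine Finset.sum_congr rfl fun i _ => ?_
      simp only [φ]
      split_ifs <;> simp
    rw [h1]
    apply hM
    · simp
    · intro i hi j hj hij
      simp only [Finset.mem_filter, Finset.mem_erase, Finset.mem_univ, and_true] at hi hj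
      obtain ⟨⟨hip, hi0⟩, hi⟩ := hi
      obtain ⟨⟨hjp, hj0⟩, hj⟩ := hj
      have hsum := hcc i j hi0 hj0 hij
      have hcol : col i ↔ ¬ col j := by
        have a1 : (i : ℕ) ≠ 0 := fun h => hi0 (Fin.ext h)
        have a2 : (j : ℕ) ≠ 0 := fun h => hj0 (Fin.ext h)
        have a3 : (p : ℕ) ≠ 0 := fun h => hp0 (Fin.ext h)
        have a4 : (i : ℕ) ≠ p := fun h => hip (Fin.ext h)
        have a5 : (j : ℕ) ≠ p := fun h => hjp (Fin.ext h)
        have := i.2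
        have := j.2
        have := p.2
        simp only [col, Fin.lt_def]
        unfold consec at hij
        split_ifs <;> omega
      by_cases hc : col i
      · have hc' := hcol.1 hc
        rw [if_pos hc] at hi
        rw [if_neg hc'] at hj
        linarith
      · have hc' : col j := by tauto
        rw [if_neg hc] at hi
        rw [if_pos hc'] at hj
        linarith
  have hpm : p ∈ (Finset.univ.erase (0 : Fin (2*k+2))) := by simp [hp0]
  rw [← Finset.add_sum_erase _ _ hpm, hp, zero_mul, zero_add]
  have h2 : ∑ i ∈ (Finset.univ.erase 0).erase p, c i * x i
      = ∫ t in (0 : ℝ)..B, ∑ i ∈ (Finset.univ.erase 0).erase p, φ i t * x i := by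
    rw [intervalIntegral.integral_finsetSum (fun i _ => (hint i).mul_const _)]
    refine Finset.sum_congr rfl fun i hi => ?_
    rw [intervalIntegral.integral_mul_const, hval i (by simp at hi; exact hi.2)]
  rw [h2]
  have h3 : ∫ t in (0 : ℝ)..B, M = B * M := by simp
  rw [← h3]
  apply intervalIntegral.integral_mono_on hB _ intervalIntegrable_const hpt
  have := IntervalIntegrable.sum ((Finset.univ.erase (0 : Fin (2*k+2))).erase p)
    (f := fun i t => φ i t * x i) (fun i _ => (hint i).mul_const (x i))
  have e : (fun t => ∑ i ∈ (Finset.univ.erase 0).erase p, φ i t * x i)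
      = ∑ i ∈ (Finset.univ.erase 0).erase p, fun t => φ i t * x i := by
    funext t
    simp only [Finset.sum_apply]
  rw [e]
  exact this

lemma exists_next (k : ℕ) (hk : 2 ≤ k) (i : Fin (2*k+2)) (hi : i ≠ 0) :
    ∃ j : Fin (2*k+2), j ≠ 0 ∧ j ≠ i ∧ consec k i j := by
  have h1 : (i : ℕ) ≠ 0 := fun h => hi (Fin.ext h)
  have := i.2
  by_cases h : (i : ℕ) = 2*k+1
  · refine ⟨⟨1, by omega⟩, ?_, ?_, ?_⟩
    · simp [Fin.ext_iff]
    · intro h'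
      have := congrArg Fin.val h'
      simp only at this
      omega
    · right; right; right; exact ⟨h, rfl⟩
  · refine ⟨⟨(i : ℕ) + 1, by omega⟩, ?_, ?_, Or.inl rfl⟩
    · intro h'
      have := congrArg Fin.val h'
      simp only [Fin.val_zero] at this
      omega
    · intro h'
      have := congrArg Fin.val h'
      simp only at this
      omega

lemma cycle_bound (k : ℕ) (hk : 2 ≤ k) (c x : Fin (2*k+2) → ℝ) (u M : ℝ)
    (hc0 : ∀ i, i ≠ 0 → 0 ≤ c i)
    (hcc : ∀ i j, i ≠ 0 → j ≠ 0 → consec k i j → c i + c j ≤ u)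
    (hM : ∀ S : Finset (Fin (2*k+2)), 0 ∉ S → (∀ i ∈ S, ∀ j ∈ S, ¬ consec k i j) →
      ∑ i ∈ S, x i ≤ M)
    (hM2 : ∑ i ∈ Finset.univ.erase 0, x i ≤ 2 * M) :
    ∑ i ∈ Finset.univ.erase 0, c i * x i ≤ u * M := by
  classical
  have hne : (Finset.univ.erase (0 : Fin (2*k+2))).Nonempty :=
    ⟨⟨1, by omega⟩, by simp [Fin.ext_iff]⟩
  obtain ⟨p, hpm, hpmin⟩ := Finset.exists_min_image _ c hne
  have hp0 : p ≠ 0 := by simpa using hpm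
  have hmin : ∀ i, i ≠ 0 → c p ≤ c i := fun i hi => hpmin i (by simp [hi])
  have hcu : ∀ i, i ≠ 0 → c i + c p ≤ u := by
    intro i hi
    obtain ⟨j, hj0, -, hij⟩ := exists_next k hk i hi
    linarith [hcc i j hi hj0 hij, hmin j hj0]
  have h := path_bound k (fun i => c i - c p) x (u - 2 * c p) M p
    (by linarith [hcu p hp0]) (fun i hi => by linarith [hmin i hi])
    (fun i hi => by linarith [hcu i hi])
    (fun i j hi hj hij => by linarith [hcc i j hi hj hij]) hp0 (sub_self _) hM
  have e : ∑ i ∈ Finset.univ.erase 0, (c i - c p) * x i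
      = ∑ i ∈ Finset.univ.erase 0, c i * x i - c p * ∑ i ∈ Finset.univ.erase 0, x i := by
    rw [Finset.mul_sum, ← Finset.sum_sub_distrib]
    exact Finset.sum_congr rfl fun i _ => by ring
  have h3 := mul_le_mul_of_nonneg_left hM2 (hc0 p hp0)
  rw [e] at h
  linarith

lemma join_perfect (k : ℕ) (hk : 2 ≤ k) (G : SimpleGraph (Fin (2*k+2)))
    (hanti : ∀ i j : Fin (2*k+2), i ≠ 0 → j ≠ 0 →
      (G.Adj i j ↔ (i ≠ j ∧ ¬ consec k i j)))
    (h0 : ∀ i, i ≠ 0 → G.Adj 0 i) : LSplus (FRAC G) ⊆ STAB G := by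
  classical
  rintro x ⟨hx, Y, hY, hY0, hY1, hY2, hY3, hY4⟩
  simp only [mem_coneK_FRAC] at hY3 hY4
  have hsym : ∀ i j, Y i j = Y j i := by
    intro i j
    have := hY.isHermitian.apply j i
    simpa using this
  have hdiag : ∀ i, Y (some i) (some i) = x i := fun i => by rw [← hY1, hY2]
  have hnone : ∀ i, Y none (some i) = x i := fun i => by rw [hsym, hY2]
  have hzero : ∀ i j, G.Adj i j → Y (some i) (some j) = 0 := by
    intro i j hij
    have h1 := (hY3 j).2.2 i j hij
    have h2 := ((hY3 j).2.1 i).1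
    rw [hdiag, hnone] at h1
    linarith
  -- clique inequalities
  have hclique : ∀ S : Finset (Fin (2*k+2)), (∀ i ∈ S, ∀ j ∈ S, i ≠ j → G.Adj i j) →
      ∑ i ∈ S, x i ≤ 1 := by
    intro S hS
    have := psd_valid Y hY hY0 x (fun i => if i ∈ S then 1 else 0) 1 one_pos
      (fun i => by split_ifs <;> norm_num) hY2 ?_
    · simpa using this
    · intro i hi
      have hiS : i ∈ S := by
        by_contra h
        simp [h] at hi
      rw [Finset.sum_eq_single i]
      · simp [hiS, hdiag]
      · intro j _ hji
        by_cases hj : j ∈ S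
        · simp [hzero j i (hS j hj i hiS hji)]
        · simp [hj]
      · simp
  have hM : ∀ S : Finset (Fin (2*k+2)), 0 ∉ S → (∀ i ∈ S, ∀ j ∈ S, ¬ consec k i j) →
      ∑ i ∈ S, x i ≤ 1 - x 0 := by
    intro S h0S hS
    have := hclique (insert 0 S) ?_
    · rw [Finset.sum_insert h0S] at this
      linarith
    · intro i hi j hj hij
      by_cases hi0 : i = 0
      · subst hi0; exact h0 j hij.symm
      by_cases hj0 : j = 0
      · subst hj0; exact (h0 i hij).symm
      rw [hanti i j hi0 hj0]
      exact ⟨hij, hS i (by simpa [hi0] using hi) j (by simpa [hj0] using hj)⟩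
  have hM2 : ∑ i ∈ Finset.univ.erase 0, x i ≤ 2 * (1 - x 0) := by
    have := psd_valid Y hY hY0 x (fun i => if i = 0 then 2 else 1) 2 two_pos
      (fun i => by split_ifs <;> norm_num) hY2 ?_
    · rw [← Finset.add_sum_erase _ _ (Finset.mem_univ (0 : Fin (2*k+2)))] at this
      rw [if_pos rfl] at this
      have e : ∑ i ∈ Finset.univ.erase 0, (if i = 0 then (2 : ℝ) else 1) * x i
          = ∑ i ∈ Finset.univ.erase 0, x i := by
        refine Finset.sum_congr rfl fun i hi => ?_
        rw [if_neg (by simpa using hi), one_mul]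
      rw [e] at this
      linarith
    · intro i _
      by_cases hi0 : i = 0
      · subst hi0
        rw [Finset.sum_eq_single 0]
        · simp [hdiag]
        · intro j _ hj
          simp [hzero j 0 (h0 j hj).symm]
        · simp
      · -- only i and its two cyclic neighbours contribute
        have hiv : (i : ℕ) ≠ 0 := fun h => hi0 (Fin.ext h)
        have hi2 := i.2
        obtain ⟨a, ha⟩ : ∃ a : Fin (2*k+2), (a : ℕ) = if (i : ℕ) = 2*k+1 then 1 else (i : ℕ) + 1 :=
          ⟨⟨if (i : ℕ) = 2*k+1 then 1 else (i : ℕ) + 1, by split_ifs <;> omega⟩, rfl⟩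
        obtain ⟨b, hb⟩ : ∃ b : Fin (2*k+2), (b : ℕ) = if (i : ℕ) = 1 then 2*k+1 else (i : ℕ) - 1 :=
          ⟨⟨if (i : ℕ) = 1 then 2*k+1 else (i : ℕ) - 1, by split_ifs <;> omega⟩, rfl⟩
        have ha0 : a ≠ 0 := by
          intro h; rw [h] at ha; simp only [Fin.val_zero] at ha; split_ifs at ha
        have hb0 : b ≠ 0 := by
          intro h; rw [h] at hb; simp only [Fin.val_zero] at hb; split_ifs at hb; omega
        have hab : a ≠ b := by
          intro h; rw [h, hb] at ha; split_ifs at ha <;> omega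
        have hai : a ≠ i := by
          intro h; rw [h] at ha; split_ifs at ha <;> omega
        have hbi : b ≠ i := by
          intro h; rw [h] at hb; split_ifs at hb <;> omega
        have hadj : G.Adj a b := by
          rw [hanti a b ha0 hb0]
          refine ⟨hab, ?_⟩
          unfold consec
          rw [ha, hb]
          split_ifs <;> omega
        have hrest : ∀ j, j ≠ i → j ≠ a → j ≠ b → Y (some j) (some i) = 0 := by
          intro j hji hja hjb
          by_cases hj0 : j = 0
          · subst hj0; exact hzero _ _ (h0 i hi0)
          apply hzero
          rw [hanti j i hj0 hi0]
          refine ⟨hji, ?_⟩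
          have h1 : (j : ℕ) ≠ a := fun h => hja (Fin.ext h)
          have h2 : (j : ℕ) ≠ b := fun h => hjb (Fin.ext h)
          rw [ha] at h1
          rw [hb] at h2
          unfold consec
          have h3 : (j : ℕ) ≠ 0 := fun h => hj0 (Fin.ext h)
          split_ifs at h1 h2 <;> omega
        have hsub : ∑ j, (if j = 0 then (2 : ℝ) else 1) * Y (some j) (some i)
            = ∑ j ∈ ({i, a, b} : Finset (Fin (2*k+2))),
              (if j = 0 then (2 : ℝ) else 1) * Y (some j) (some i) := by
          symm
          apply Finset.sum_subset (Finset.subset_univ _)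
          intro j _ hj
          simp only [Finset.mem_insert, Finset.mem_singleton, not_or] at hj
          rw [hrest j hj.1 hj.2.1 hj.2.2, mul_zero]
        rw [hsub, Finset.sum_insert (by simp [hai.symm, hbi.symm]), Finset.sum_insert (by simp [hab]),
          Finset.sum_singleton, if_neg hi0, if_neg ha0, if_neg hb0, hdiag]
        have := (hY3 i).2.2 a b hadj
        rw [hnone] at this
        linarith
  -- separation
  by_contra hxS
  have hfin : {x : Fin (2*k+2) → ℝ | ∃ S : Set (Fin (2*k+2)), IsStable G S ∧ x = S.indicator 1}.Finite := by
    refine (Set.finite_range (fun S : Set (Fin (2*k+2)) => S.indicator (1 : Fin (2*k+2) → ℝ))).subset ?_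
    rintro y ⟨S, -, rfl⟩
    exact ⟨S, rfl⟩
  obtain ⟨f, u, hfu, hux⟩ := geometric_hahn_banach_closed_point (convex_convexHull ℝ _)
    (hfin.isClosed_convexHull ℝ) hxS
  let d : Fin (2*k+2) → ℝ := fun i => f (Pi.single i 1)
  have hf : ∀ y, f y = ∑ i, y i * d i := by
    intro y
    have := LinearMap.pi_apply_eq_sum_univ (f : (Fin (2*k+2) → ℝ) →ₗ[ℝ] ℝ) y
    simp only [ContinuousLinearMap.coe_coe, smul_eq_mul] at this
    rw [this]
    refine Finset.sum_congr rfl fun i _ => ?_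
    congr 2
    ext j
    simp [Pi.single_apply, eq_comm]
  let c : Fin (2*k+2) → ℝ := fun i => max (d i) 0
  have hstab : ∀ S : Finset (Fin (2*k+2)), IsStable G (S : Set (Fin (2*k+2))) → ∑ i ∈ S, c i ≤ u := by
    intro S hS
    let T := S.filter (fun i => 0 < d i)
    have hT : IsStable G (T : Set (Fin (2*k+2))) := by
      intro a ha b hb
      exact hS a (Finset.mem_coe.2 (Finset.mem_filter.1 (Finset.mem_coe.1 ha)).1) b
        (Finset.mem_coe.2 (Finset.mem_filter.1 (Finset.mem_coe.1 hb)).1)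
    have h1 := hfu _ (subset_convexHull ℝ _ ⟨_, hT, rfl⟩)
    rw [hf] at h1
    have e : ∑ i, (T : Set (Fin (2*k+2))).indicator (1 : Fin (2*k+2) → ℝ) i * d i = ∑ i ∈ S, c i := by
      simp only [Set.indicator_apply, Finset.mem_coe, Pi.one_apply, ite_mul, one_mul, zero_mul]
      rw [Finset.sum_ite_mem, Finset.univ_inter, Finset.sum_filter]
      refine Finset.sum_congr rfl fun i _ => ?_
      simp only [c]
      split_ifs with h
      · rw [max_eq_left h.le]
      · rw [max_eq_right (not_lt.1 h)]
    linarith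
  have hc00 : c 0 ≤ u := by
    have := hstab {0} (by
      intro a ha b hb
      simp only [Finset.coe_singleton, Set.mem_singleton_iff] at ha hb
      rw [ha, hb]
      exact G.loopless.irrefl 0)
    simpa using this
  have hcc : ∀ i j, i ≠ 0 → j ≠ 0 → consec k i j → c i + c j ≤ u := by
    intro i j hi hj hij
    have hne : i ≠ j := by
      rintro rfl
      unfold consec at hij
      omega
    have hnadj : ¬ G.Adj i j := by
      rw [hanti i j hi hj]; tauto
    have := hstab {i, j} (by
      intro a ha b hb
      simp only [Finset.coe_insert, Finset.coe_singleton, Set.mem_insert_iff,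
        Set.mem_singleton_iff] at ha hb
      rcases ha with rfl | rfl <;> rcases hb with rfl | rfl
      · exact G.loopless.irrefl _
      · exact hnadj
      · exact fun h => hnadj h.symm
      · exact G.loopless.irrefl _)
    rwa [Finset.sum_pair hne] at this
  have hfinal := cycle_bound k hk c x u (1 - x 0) (fun i _ => le_max_right _ _) hcc hM hM2
  have h1 : f x ≤ ∑ i, c i * x i := by
    rw [hf]
    refine Finset.sum_le_sum fun i _ => ?_
    rw [mul_comm]
    exact mul_le_mul_of_nonneg_right (le_max_left _ _) (hx i).1
  rw [← Finset.add_sum_erase _ _ (Finset.mem_univ (0 : Fin (2*k+2)))] at h1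
  have h2 := mul_le_mul_of_nonneg_right hc00 (hx 0).1
  linarith

/-- Alternating signs on the edges `e = {e, e+1}` of the cycle, with both edges at `v` positive. -/
noncomputable def altSign (k : ℕ) (v e : Fin (2*k+2)) : ℝ :=
  if v ≤ e then (if ((e : ℕ) + v) % 2 = 0 then 1 else -1)
  else (if ((e : ℕ) + v) % 2 = 1 then 1 else -1)

/-- Incidence of node `i` with the edge starting at `e`. -/
noncomputable def inc (k : ℕ) (e i : Fin (2*k+2)) : ℝ :=
  if i = e ∨ (i : ℕ) = e + 1 ∨ ((e : ℕ) = 2*k+1 ∧ (i : ℕ) = 1) then 1 else 0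

/-- Predecessor on the cycle. -/
def prv (k : ℕ) (i : Fin (2*k+2)) : Fin (2*k+2) :=
  ⟨if (i : ℕ) = 1 then 2*k+1 else (i : ℕ) - 1, by have := i.2; split_ifs <;> omega⟩

/-- The generating vectors of the certificate. -/
noncomputable def vecs (k : ℕ) (v e : Fin (2*k+2)) : Option (Fin (2*k+2)) → ℝ
  | none => 1
  | some i => if e = 0 then (if i = 0 then 3/2 else 0)
      else (if i = 0 then altSign k v e / (2 * (2*k+1)) else inc k e i)

noncomputable def wts (k : ℕ) (e : Fin (2*k+2)) : ℝ :=
  if e = 0 then 1 / (3 * (2*k+1)^2 + 1) else 3 * (2*k+1) / (3 * (2*k+1)^2 + 1)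

noncomputable def certY (k : ℕ) (v : Fin (2*k+2)) :
    Matrix (Option (Fin (2*k+2))) (Option (Fin (2*k+2))) ℝ :=
  ∑ e, wts k e • Matrix.vecMulVec (vecs k v e) (vecs k v e)

lemma certY_apply (k : ℕ) (v : Fin (2*k+2)) (i j) :
    certY k v i j = ∑ e, wts k e * (vecs k v e i * vecs k v e j) := by
  simp [certY, Matrix.sum_apply, Matrix.vecMulVec_apply]

lemma certY_psd (k : ℕ) (v : Fin (2*k+2)) : (certY k v).PosSemidef := by
  unfold certY
  refine Matrix.posSemidef_sum _ fun e _ => ?_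
  refine Matrix.PosSemidef.smul (by simpa using Matrix.posSemidef_vecMulVec_self_star (vecs k v e)) ?_
  unfold wts
  split_ifs <;> positivity

lemma certY_symm (k : ℕ) (v : Fin (2*k+2)) (i j) : certY k v i j = certY k v j i := by
  rw [certY_apply, certY_apply]
  exact Finset.sum_congr rfl fun e _ => by ring

lemma prv_ne_zero (k : ℕ) (i : Fin (2*k+2)) (hi : i ≠ 0) : prv k i ≠ 0 := by
  have h1 : (i : ℕ) ≠ 0 := fun h => hi (Fin.ext h)
  intro h
  have := congrArg Fin.val h
  simp only [prv, Fin.val_zero] at this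
  split_ifs at this
  omega

lemma prv_ne (k : ℕ) (hk : 2 ≤ k) (i : Fin (2*k+2)) (hi : i ≠ 0) : prv k i ≠ i := by
  have h1 : (i : ℕ) ≠ 0 := fun h => hi (Fin.ext h)
  intro h
  have := congrArg Fin.val h
  simp only [prv] at this
  split_ifs at this <;> omega

lemma sum_vecs (k : ℕ) (hk : 2 ≤ k) (v i : Fin (2*k+2)) (hi : i ≠ 0) (f : Fin (2*k+2) → ℝ) :
    ∑ e, f e * vecs k v e (some i) = f i + f (prv k i) := by
  have hp := prv_ne_zero k i hi
  have hpi := prv_ne k hk i hi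
  have h1 : (i : ℕ) ≠ 0 := fun h => hi (Fin.ext h)
  have hpv : (prv k i : ℕ) = if (i : ℕ) = 1 then 2*k+1 else (i : ℕ) - 1 := rfl
  have hsub : ∑ e, f e * vecs k v e (some i)
      = ∑ e ∈ ({i, prv k i} : Finset (Fin (2*k+2))), f e * vecs k v e (some i) := by
    symm
    apply Finset.sum_subset (Finset.subset_univ _)
    intro e _ he
    simp only [Finset.mem_insert, Finset.mem_singleton, not_or] at he
    have h2 : (e : ℕ) ≠ i := fun h => he.1 (Fin.ext h)
    have h3 : (e : ℕ) ≠ prv k i := fun h => he.2 (Fin.ext h)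
    rw [hpv] at h3
    by_cases he0 : e = 0
    · simp [vecs, he0, hi]
    · have h4 : (e : ℕ) ≠ 0 := fun h => he0 (Fin.ext h)
      simp only [vecs, if_neg he0, if_neg hi, inc]
      rw [if_neg, mul_zero]
      rw [Fin.ext_iff]
      split_ifs at h3 <;> omega
  rw [hsub, Finset.sum_pair hpi.symm]
  simp only [vecs, if_neg hi, if_neg hp, inc]
  rw [if_pos (Or.inl trivial), if_pos, mul_one, mul_one]
  right
  rw [hpv]
  split_ifs <;> omega

lemma certY_none_none (k : ℕ) (v : Fin (2*k+2)) : certY k v none none = 1 := by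
  rw [certY_apply]
  simp only [vecs, mul_one]
  rw [← Finset.add_sum_erase _ _ (Finset.mem_univ (0 : Fin (2*k+2)))]
  have : ∑ e ∈ Finset.univ.erase (0 : Fin (2*k+2)), wts k e
      = ∑ e ∈ Finset.univ.erase (0 : Fin (2*k+2)), 3 * (2*k+1) / (3 * (2*k+1)^2 + 1 : ℝ) := by
    refine Finset.sum_congr rfl fun e he => ?_
    rw [wts, if_neg (by simpa using he)]
  rw [this, Finset.sum_const, Finset.card_erase_of_mem (Finset.mem_univ _), Finset.card_univ,
    Fintype.card_fin, wts, if_pos rfl]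
  have : 2 * k + 2 - 1 = 2 * k + 1 := by omega
  rw [this, nsmul_eq_mul]
  push_cast
  field_simp
  ring

lemma certY_none_some (k : ℕ) (hk : 2 ≤ k) (v i : Fin (2*k+2)) (hi : i ≠ 0) :
    certY k v none (some i) = 2 * (3 * (2*k+1) / (3 * (2*k+1)^2 + 1)) := by
  rw [certY_apply]
  have : ∀ e, wts k e * (vecs k v e none * vecs k v e (some i))
      = wts k e * vecs k v e (some i) := fun e => by simp [vecs]
  simp only [this]
  rw [sum_vecs k hk v i hi, wts, wts, if_neg hi, if_neg (prv_ne_zero k i hi)]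
  ring

lemma certY_some_some (k : ℕ) (hk : 2 ≤ k) (v i j : Fin (2*k+2)) (hi : i ≠ 0) (hj : j ≠ 0) 
    [Decidable (consec k i j)] :
    certY k v (some i) (some j) = (3 * (2*k+1) / (3 * (2*k+1)^2 + 1)) *
      (if i = j then 2 else if consec k i j then 1 else 0) := by
  rw [certY_apply]
  have hp := prv_ne_zero k j hj
  have : ∀ e, wts k e * (vecs k v e (some i) * vecs k v e (some j))
      = (wts k e * vecs k v e (some i)) * vecs k v e (some j) := fun e => by ring
  simp only [this]
  rw [sum_vecs k hk v j hj, wts, wts, if_neg hj, if_neg hp, ← mul_add]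
  congr 1
  have h1 : (i : ℕ) ≠ 0 := fun h => hi (Fin.ext h)
  have h2 : (j : ℕ) ≠ 0 := fun h => hj (Fin.ext h)
  have hi2 := i.2
  have hj2 := j.2
  simp only [vecs, if_neg hj, if_neg hi, if_neg hp]
  have hq : ((j : ℕ) = 1 ∧ (prv k j : ℕ) = 2*k+1) ∨ ((j : ℕ) ≠ 1 ∧ (prv k j : ℕ) = j - 1) := by
    simp only [prv]
    split_ifs <;> omega
  generalize prv k j = q at hq
  simp only [inc, Fin.ext_iff]
  by_cases hcs : consec k i j
  · rw [if_pos hcs]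
    unfold consec at hcs
    split_ifs <;> first | (exfalso; omega) | norm_num
  · rw [if_neg hcs]
    unfold consec at hcs
    split_ifs <;> first | (exfalso; omega) | norm_num

lemma altSign_add (k : ℕ) (v i : Fin (2*k+2)) (hv : v ≠ 0) (hi : i ≠ 0) :
    altSign k v i + altSign k v (prv k i) = if i = v then 2 else 0 := by
  have h1 : (i : ℕ) ≠ 0 := fun h => hi (Fin.ext h)
  have h2 : (v : ℕ) ≠ 0 := fun h => hv (Fin.ext h)
  have hi2 := i.2
  have hv2 := v.2
  simp only [altSign, Fin.le_def, prv, Fin.ext_iff]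
  by_cases a : (i : ℕ) = 1
  · simp only [a, if_true]
    split_ifs <;> first | (exfalso; omega) | norm_num
  · simp only [a, if_false]
    split_ifs <;> first | (exfalso; omega) | norm_num

lemma certY_zero_some (k : ℕ) (hk : 2 ≤ k) (v i : Fin (2*k+2)) (hv : v ≠ 0) (hi : i ≠ 0) :
    certY k v (some 0) (some i) = if i = v then 3 / (3 * (2*k+1)^2 + 1 : ℝ) else 0 := by
  rw [certY_apply]
  have : ∀ e, wts k e * (vecs k v e (some 0) * vecs k v e (some i))
      = (wts k e * vecs k v e (some 0)) * vecs k v e (some i) := fun e => by ring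
  simp only [this]
  rw [sum_vecs k hk v i hi, wts, wts, if_neg hi, if_neg (prv_ne_zero k i hi), ← mul_add]
  simp only [vecs, if_neg hi, if_neg (prv_ne_zero k i hi), if_true]
  rw [← add_div, altSign_add k v i hv hi]
  split_ifs
  · field_simp
  · simp

lemma sum_altSign (k : ℕ) (hk : 2 ≤ k) (v : Fin (2*k+2)) (hv : v ≠ 0) :
    ∑ e ∈ Finset.univ.erase 0, altSign k v e = 1 := by
  have h1 : ∑ i ∈ Finset.univ.erase 0, (altSign k v i + altSign k v (prv k i)) = 2 := by
    have : ∑ i ∈ Finset.univ.erase 0, (altSign k v i + altSign k v (prv k i))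
        = ∑ i ∈ Finset.univ.erase 0, if i = v then (2 : ℝ) else 0 :=
      Finset.sum_congr rfl fun i hi => altSign_add k v i hv (by simpa using hi)
    rw [this, Finset.sum_ite_eq', if_pos (by simp [hv])]
  have h2 : ∑ i ∈ Finset.univ.erase 0, altSign k v (prv k i)
      = ∑ i ∈ Finset.univ.erase 0, altSign k v i := by
    refine Finset.sum_bij (fun i _ => prv k i) ?_ ?_ ?_ ?_
    · intro i hi
      simp [prv_ne_zero k i (by simpa using hi)]
    · intro i hi j hj hij
      have hi0 : i ≠ 0 := by simpa using hi
      have hj0 : j ≠ 0 := by simpa using hj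
      have a1 : (i : ℕ) ≠ 0 := fun h => hi0 (Fin.ext h)
      have a2 : (j : ℕ) ≠ 0 := fun h => hj0 (Fin.ext h)
      have hi2 := i.2
      have hj2 := j.2
      have := congrArg Fin.val hij
      simp only [prv] at this
      apply Fin.ext
      split_ifs at this <;> omega
    · intro b hb
      have hb0 : b ≠ 0 := by simpa using hb
      have a1 : (b : ℕ) ≠ 0 := fun h => hb0 (Fin.ext h)
      have hb2 := b.2
      by_cases h : (b : ℕ) = 2*k+1
      · refine ⟨⟨1, by omega⟩, by simp, Fin.ext ?_⟩
        simp [prv, h]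
      · refine ⟨⟨(b : ℕ) + 1, by omega⟩, by simp, Fin.ext ?_⟩
        simp [prv, a1]
    · intro i _; rfl
  rw [Finset.sum_add_distrib, h2] at h1
  linarith

lemma certY_none_zero (k : ℕ) (hk : 2 ≤ k) (v : Fin (2*k+2)) (hv : v ≠ 0) :
    certY k v none (some 0) = 3 / (3 * (2*k+1)^2 + 1) := by
  rw [certY_apply, ← Finset.add_sum_erase _ _ (Finset.mem_univ (0 : Fin (2*k+2)))]
  have : ∑ e ∈ Finset.univ.erase (0 : Fin (2*k+2)), wts k e * (vecs k v e none * vecs k v e (some 0))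
      = ∑ e ∈ Finset.univ.erase (0 : Fin (2*k+2)),
        3 * (2*k+1) / (3 * (2*k+1)^2 + 1 : ℝ) / (2 * (2*k+1)) * altSign k v e := by
    refine Finset.sum_congr rfl fun e he => ?_
    have he' : e ≠ 0 := by simpa using he
    simp only [wts, vecs, if_neg he', if_true]
    ring
  rw [this, ← Finset.mul_sum, sum_altSign k hk v hv]
  simp only [wts, vecs, if_true]
  field_simp
  ring

lemma certY_zero_zero (k : ℕ) (v : Fin (2*k+2)) :
    certY k v (some 0) (some 0) = 3 / (3 * (2*k+1)^2 + 1) := by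
  rw [certY_apply, ← Finset.add_sum_erase _ _ (Finset.mem_univ (0 : Fin (2*k+2)))]
  have : ∑ e ∈ Finset.univ.erase (0 : Fin (2*k+2)),
        wts k e * (vecs k v e (some 0) * vecs k v e (some 0))
      = ∑ e ∈ Finset.univ.erase (0 : Fin (2*k+2)),
        3 * (2*k+1) / (3 * (2*k+1)^2 + 1 : ℝ) / (2 * (2*k+1)) ^ 2 := by
    refine Finset.sum_congr rfl fun e he => ?_
    have he' : e ≠ 0 := by simpa using he
    have hs : altSign k v e * altSign k v e = 1 := by
      unfold altSign
      split_ifs <;> norm_num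
    simp only [wts, vecs, if_neg he', if_true]
    rw [div_mul_div_comm, hs]
    ring
  rw [this, Finset.sum_const, Finset.card_erase_of_mem (Finset.mem_univ _), Finset.card_univ,
    Fintype.card_fin]
  have : 2 * k + 2 - 1 = 2 * k + 1 := by omega
  rw [this, nsmul_eq_mul]
  simp only [wts, vecs, if_true]
  push_cast
  field_simp
  ring

lemma sum_le_of_mem_STAB {V : Type} [Fintype V] (G : SimpleGraph V) (x : V → ℝ)
    (hx : x ∈ STAB G) : ∑ i, x i ≤ stabNum G := by
  classical
  have hconv : Convex ℝ {y : V → ℝ | ∑ i, y i ≤ stabNum G} := by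
    intro y hy z hz a b ha hb hab
    simp only [Set.mem_setOf_eq, Pi.add_apply, Pi.smul_apply, smul_eq_mul] at *
    rw [Finset.sum_add_distrib, ← Finset.mul_sum, ← Finset.mul_sum]
    have h1 := mul_le_mul_of_nonneg_left hy ha
    have h2 := mul_le_mul_of_nonneg_left hz hb
    calc _ ≤ a * (stabNum G : ℝ) + b * stabNum G := add_le_add h1 h2
      _ = stabNum G := by rw [← add_mul, hab, one_mul]
  refine convexHull_min ?_ hconv hx
  rintro y ⟨S, hS, rfl⟩
  have h1 : S.ncard ≤ stabNum G := by
    refine le_csSup ⟨Fintype.card V, ?_⟩ ⟨S, hS, rfl⟩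
    rintro n ⟨T, -, rfl⟩
    rw [← Nat.card_eq_fintype_card]
    exact Set.ncard_le_card T
  have h2 : ∑ i, S.indicator (1 : V → ℝ) i = S.ncard := by
    rw [Set.ncard_eq_toFinset_card']
    simp [Set.indicator_apply, Finset.sum_boole, Set.toFinset_card, Fintype.card_subtype]
  show ∑ i, S.indicator (1 : V → ℝ) i ≤ stabNum G
  rw [h2]
  exact_mod_cast h1

lemma not_adj_imperfect (k : ℕ) (hk : 2 ≤ k) (G : SimpleGraph (Fin (2*k+2)))
    (hanti : ∀ i j : Fin (2*k+2), i ≠ 0 → j ≠ 0 →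
      (G.Adj i j ↔ (i ≠ j ∧ ¬ consec k i j)))
    (v : Fin (2*k+2)) (hv : v ≠ 0) (hv0 : ¬ G.Adj 0 v) :
    ∃ x ∈ LSplus (FRAC G), 2 < ∑ i, x i := by
  classical
  obtain ⟨ε, hε⟩ : ∃ ε : ℝ, ε = 3 / (3 * (2*k+1)^2 + 1) := ⟨_, rfl⟩
  obtain ⟨w, hw⟩ : ∃ w : ℝ, w = 3 * (2*k+1) / (3 * (2*k+1)^2 + 1) := ⟨_, rfl⟩
  have hkR : (2 : ℝ) ≤ k := by exact_mod_cast hk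
  have hε0 : 0 < ε := by rw [hε]; positivity
  have hwn : w = (2*k+1) * ε := by rw [hw, hε]; ring
  have hw1 : (2*k+1) * w + ε / 3 = 1 := by rw [hw, hε]; field_simp
  have hw0 : 0 < w := by rw [hwn]; positivity
  have hw5 : 5 * ε ≤ w := by rw [hwn]; nlinarith
  have h5w : 5 * w + ε / 3 ≤ 1 := by nlinarith
  have h6w : 3 ≤ k → 6 * w ≤ 1 := by
    intro h
    have : (3 : ℝ) ≤ k := by exact_mod_cast h
    nlinarith
  have Ynn := certY_none_none k v
  have Yn0 := certY_none_zero k hk v hv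
  have Yni := fun i hi => certY_none_some k hk v i hi
  have Y00 := certY_zero_zero k v
  have Y0i := fun i hi => certY_zero_some k hk v i hv hi
  have Yij := fun i j hi hj => certY_some_some k hk v i j hi hj
  have hsym := certY_symm k v
  have hpsd := certY_psd k v
  rw [← hε] at Yn0 Y00
  simp only [← hε] at Y0i
  simp only [← hw] at Yni Yij
  generalize certY k v = Y at *
  have Yi0 : ∀ i, i ≠ 0 → Y (some i) (some 0) = if i = v then ε else 0 := fun i hi => by
    rw [hsym, Y0i i hi]
  have Y0n : Y (some 0) none = ε := by rw [hsym, Yn0]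
  have Yin : ∀ i, i ≠ 0 → Y (some i) none = 2 * w := fun i hi => by rw [hsym, Yni i hi]
  have hadj0 : ∀ j, G.Adj 0 j → j ≠ 0 ∧ j ≠ v := by
    intro j hj
    refine ⟨fun h => ?_, fun h => ?_⟩
    · rw [h] at hj; exact G.loopless.irrefl _ hj
    · rw [h] at hj; exact hv0 hj
  -- combinatorial facts on the cycle
  have htri : ∀ i a b : Fin (2*k+2), i ≠ 0 → a ≠ 0 → b ≠ 0 → a ≠ b → ¬ consec k a b →
      a ≠ i → b ≠ i → ¬ consec k a i → ¬ consec k b i → 3 ≤ k := by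
    intro i a b hi ha hb hab hcab hai hbi hcai hcbi
    have a1 : (i : ℕ) ≠ 0 := fun h => hi (Fin.ext h)
    have a2 : (a : ℕ) ≠ 0 := fun h => ha (Fin.ext h)
    have a3 : (b : ℕ) ≠ 0 := fun h => hb (Fin.ext h)
    have a4 : (a : ℕ) ≠ b := fun h => hab (Fin.ext h)
    have a5 : (a : ℕ) ≠ i := fun h => hai (Fin.ext h)
    have a6 : (b : ℕ) ≠ i := fun h => hbi (Fin.ext h)
    have := i.2
    have := a.2
    have := b.2
    by_contra hk3
    have hk2 : k = 2 := by omega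
    subst hk2
    unfold consec at hcab hcai hcbi
    omega
  have hself : ∀ a b, consec k a b → consec k b a := by
    intro a b h
    unfold consec at *
    omega
  refine ⟨fun i => Y (some i) none, ⟨fun i => ?_, Y, hpsd, Ynn, ?_, fun i => rfl, ?_, ?_⟩, ?_⟩
  · show 0 ≤ Y (some i) none ∧ Y (some i) none ≤ 1
    by_cases hi : i = 0
    · rw [hi, Y0n]; constructor <;> linarith
    · rw [Yin i hi]; constructor <;> linarith
  · rintro (_ | j)
    · rfl
    · by_cases hj : j = 0
      · rw [hj, Y0n, Y00]
      · rw [Yin j hj, Yij j j hj hj, if_pos rfl]; ring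
  · intro i
    rw [mem_coneK_FRAC]
    by_cases hi : i = 0
    · subst hi
      simp only [Yn0]
      refine ⟨hε0.le, fun j => ?_, ?_⟩
      · by_cases hj : j = 0
        · rw [hj, Y00]; constructor <;> linarith
        · rw [Yi0 j hj]; split_ifs <;> constructor <;> linarith
      · intro a b hab
        by_cases ha : a = 0
        · subst ha
          obtain ⟨hb, hbv⟩ := hadj0 b hab
          rw [Y00, Yi0 b hb, if_neg hbv]; linarith
        by_cases hb : b = 0
        · subst hb
          obtain ⟨ha, hav⟩ := hadj0 a hab.symm
          rw [Y00, Yi0 a ha, if_neg hav]; linarith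
        rw [Yi0 a ha, Yi0 b hb]
        have := hab.ne
        split_ifs with h1 h2
        · exact absurd (h1.trans h2.symm) this
        all_goals linarith
    · simp only [Yni i hi]
      refine ⟨by linarith, fun j => ?_, ?_⟩
      · by_cases hj : j = 0
        · rw [hj, Y0i i hi]; split_ifs <;> constructor <;> linarith
        · rw [Yij j i hj hi]; split_ifs <;> constructor <;> linarith
      · have key : ∀ b, G.Adj 0 b → Y (some 0) (some i) + Y (some b) (some i) ≤ 2 * w := by
          intro b hab
          obtain ⟨hb, hbv⟩ := hadj0 b hab
          rw [Y0i i hi, Yij b i hb hi]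
          split_ifs with h1 h2
          · exact absurd (h2.trans h1) hbv
          all_goals linarith
        intro a b hab
        by_cases ha : a = 0
        · subst ha; exact key b hab
        by_cases hb : b = 0
        · subst hb; rw [add_comm]; exact key a hab.symm
        obtain ⟨hne, hnc⟩ := (hanti a b ha hb).1 hab
        rw [Yij a i ha hi, Yij b i hb hi]
        split_ifs with h1 h2 h3 h4 h5
        · exact absurd (h1.trans h2.symm) hne
        · rw [h1] at hnc; exact absurd (hself _ _ h3) hnc
        · linarith
        · rw [h5] at hnc; exact absurd h4 hnc
        all_goals linarith
  · intro i
    rw [mem_coneK_FRAC]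
    by_cases hi : i = 0
    · subst hi
      simp only [Yn0, Ynn]
      have hpos : ∀ j, 0 ≤ Y (some j) none - Y (some j) (some 0) ∧
          Y (some j) none - Y (some j) (some 0) ≤ 2 * w := by
        intro j
        by_cases hj : j = 0
        · rw [hj, Y0n, Y00]; constructor <;> linarith
        · rw [Yin j hj, Yi0 j hj]; split_ifs <;> constructor <;> linarith
      refine ⟨by linarith, fun j => ⟨(hpos j).1, by linarith [(hpos j).2]⟩, fun a b _ => ?_⟩
      linarith [(hpos a).2, (hpos b).2]
    · simp only [Yni i hi, Ynn]
      have hpos : ∀ j, 0 ≤ Y (some j) none - Y (some j) (some i) ∧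
          Y (some j) none - Y (some j) (some i) ≤ 2 * w := by
        intro j
        by_cases hj : j = 0
        · rw [hj, Y0n, Y0i i hi]; split_ifs <;> constructor <;> linarith
        · rw [Yin j hj, Yij j i hj hi]; split_ifs <;> constructor <;> linarith
      have hz : Y (some 0) none - Y (some 0) (some i) ≤ ε := by
        rw [Y0n, Y0i i hi]; split_ifs <;> linarith
      refine ⟨by linarith, fun j => ⟨(hpos j).1, by linarith [(hpos j).2]⟩, fun a b hab => ?_⟩
      by_cases ha : a = 0
      · subst ha
        linarith [(hpos b).2]
      by_cases hb : b = 0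
      · subst hb
        linarith [(hpos a).2]
      obtain ⟨hne, hnc⟩ := (hanti a b ha hb).1 hab
      have ht := htri i a b hi ha hb hne hnc
      rw [Yin a ha, Yin b hb, Yij a i ha hi, Yij b i hb hi]
      split_ifs with h1 h2 h3 h4 h5 h6 h7 h8
      all_goals first
        | linarith
        | (have := h6w (ht (by assumption) (by assumption) (by assumption) (by assumption))
           linarith)
  · rw [← Finset.add_sum_erase _ _ (Finset.mem_univ (0 : Fin (2*k+2))), Y0n]
    have : ∑ i ∈ Finset.univ.erase (0 : Fin (2*k+2)), Y (some i) none
        = ∑ i ∈ Finset.univ.erase (0 : Fin (2*k+2)), 2 * w :=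
      Finset.sum_congr rfl fun i hi => Yin i (by simpa using hi)
    rw [this, Finset.sum_const, Finset.card_erase_of_mem (Finset.mem_univ _), Finset.card_univ,
      Fintype.card_fin]
    have : 2 * k + 2 - 1 = 2 * k + 1 := by omega
    rw [this, nsmul_eq_mul]
    push_cast
    linarith


/-- Let `G` on `{0,…,2k+1}` (`k ≥ 2`) be such that `G - 0` is the complement of
`C_{2k+1}` and `α(G) = 2`.  Then `G` is `LS₊`-perfect iff `deg_G(0) = 2k+1`. -/
theorem stmt19 (k : ℕ) (hk : 2 ≤ k) (G : SimpleGraph (Fin (2*k+2)))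
    (hanti : ∀ i j : Fin (2*k+2), i ≠ 0 → j ≠ 0 →
      (G.Adj i j ↔ (i ≠ j ∧ ¬ consec k i j)))
    (halpha : stabNum G = 2) :
    LSplus (FRAC G) = STAB G ↔ (G.neighborSet 0).ncard = 2*k+1 := by
  classical
  have hsubset : G.neighborSet 0 ⊆ {0}ᶜ := by
    intro i hi h
    rw [Set.mem_singleton_iff.1 h] at hi
    exact G.loopless.irrefl _ hi
  have hcard : ({0}ᶜ : Set (Fin (2*k+2))).ncard = 2*k+1 := by
    rw [Set.ncard_compl, Set.ncard_singleton, Nat.card_eq_fintype_card, Fintype.card_fin]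
    omega
  constructor
  · intro h
    by_contra hne
    have : ∃ v : Fin (2*k+2), v ≠ 0 ∧ ¬ G.Adj 0 v := by
      by_contra hcon
      push Not at hcon
      apply hne
      rw [← hcard]
      congr 1
      exact Set.Subset.antisymm hsubset fun i hi => hcon i hi
    obtain ⟨v, hv, hv0⟩ := this
    obtain ⟨x, hx, hsum⟩ := not_adj_imperfect k hk G hanti v hv hv0
    rw [h] at hx
    have := sum_le_of_mem_STAB G x hx
    rw [halpha] at this
    push_cast at this
    linarith
  · intro h
    have heq : G.neighborSet 0 = {0}ᶜ :=
      Set.eq_of_subset_of_ncard_le hsubset (by rw [h, hcard])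
    have h0 : ∀ i, i ≠ 0 → G.Adj 0 i := by
      intro i hi
      have : i ∈ G.neighborSet 0 := by rw [heq]; exact hi
      exact this
    exact Set.Subset.antisymm (join_perfect k hk G hanti h0) (STAB_subset_LSplus G)
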